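/- Let (Y_j)_{j≥0} be a centered stationary Gaussian sequence of real random variables with E[Y_j] = 0, E[Y_j²] = 1 and covariances r_k = E[Y_0 Y_k] = e^{-k/2}. Then with probability one, liminf_{k→∞} [max_{0 ≤ j ≤ k} Y_j − √(2 log k)] ≥ 0. -/

import Mathlib

open MeasureTheory ProbabilityTheory Filter

theorem aux_gp {Ω : Type*} [MeasurableSpace Ω] (P : Measure Ω) [IsProbabilityMeasure P]
    (Y : ℕ → Ω → ℝ)
    (hmeas : ∀ j, Measurable (Y j))
    (hGauss : ∀ (s : Finset ℕ) (c : ℕ → ℝ), ∃ v : NNReal,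
      P.map (fun ω => ∑ j ∈ s, c j * Y j ω) = gaussianReal 0 v) :
    IsGaussianProcess Y P := by
  constructor
  intro I
  constructor
  apply isGaussian_of_map_eq_gaussianReal
  intro L
  classical
  obtain ⟨v, hv⟩ := hGauss I (fun j => if h : j ∈ I then L (Pi.single ⟨j, h⟩ 1) else 0)
  refine ⟨0, v, ?_⟩
  rw [← hv, Measure.map_map (by fun_prop) (by unfold Finset.restrict; fun_prop)]
  congr 1
  ext ω
  rw [← Finset.sum_coe_sort]
  simp only [Function.comp_apply]
  have h1 : I.restrict (fun j => Y j ω) = ∑ i : I, (Y i ω) • (Pi.single i (1:ℝ) : I → ℝ) := by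
    ext j
    simp [Finset.sum_apply, Pi.single_apply]
  rw [h1, map_sum]
  refine Finset.sum_congr rfl fun i _ => ?_
  simp [mul_comm]

theorem aux_mean {Ω : Type*} [MeasurableSpace Ω] (P : Measure Ω) [IsProbabilityMeasure P]
    (Y : ℕ → Ω → ℝ)
    (hmeas : ∀ j, Measurable (Y j))
    (hGauss : ∀ (s : Finset ℕ) (c : ℕ → ℝ), ∃ v : NNReal,
      P.map (fun ω => ∑ j ∈ s, c j * Y j ω) = gaussianReal 0 v) (j : ℕ) :
    ∫ ω, Y j ω ∂P = 0 := by
  obtain ⟨v, hv⟩ := hGauss {j} 1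
  have h2 : ∫ x, x ∂(P.map (Y j)) = 0 := by
    simp at hv
    rw [hv]; simp
  rwa [integral_map (hmeas j).aemeasurable (by fun_prop)] at h2

theorem aux_tail (s δ : ℝ) (hs : 0 ≤ s) (hδ : 0 ≤ δ) :
    δ * ((√(2 * Real.pi))⁻¹ * Real.exp (-(s+δ)^2/2)) ≤ (gaussianReal 0 1).real (Set.Ici s) := by
  have h1 : (gaussianReal 0 1).real (Set.Icc s (s+δ)) ≤ (gaussianReal 0 1).real (Set.Ici s) :=
    measureReal_mono Set.Icc_subset_Ici_self
  refine le_trans ?_ h1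
  rw [measureReal_def, gaussianReal_apply_eq_integral _ (by norm_num), ENNReal.toReal_ofReal
    (integral_nonneg fun x => gaussianPDFReal_nonneg _ _ _)]
  have := setIntegral_mono_on (μ := volume) (s := Set.Icc s (s+δ))
    (f := fun _ => ((√(2 * Real.pi))⁻¹ * Real.exp (-(s+δ)^2/2))) (g := gaussianPDFReal 0 1)
    continuous_const.integrableOn_Icc (integrable_gaussianPDFReal 0 1).integrableOn measurableSet_Icc ?_
  · simpa [hδ] using this
  · intro x hx
    simp only [gaussianPDFReal, NNReal.coe_one, mul_one, sub_zero]
    gcongr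
    · linarith [hx.1]
    · exact hx.2

theorem aux_block {Ω : Type*} [MeasurableSpace Ω] (P : Measure Ω) [IsProbabilityMeasure P]
    (Y : ℕ → Ω → ℝ)
    (hmeas : ∀ j, Measurable (Y j))
    (hGauss : ∀ (s : Finset ℕ) (c : ℕ → ℝ), ∃ v : NNReal,
      P.map (fun ω => ∑ j ∈ s, c j * Y j ω) = gaussianReal 0 v)
    (hvar : ∀ j, ∫ ω, (Y j ω) ^ 2 ∂P = 1)
    (hcov : ∀ i j, ∫ ω, Y i ω * Y j ω ∂P = Real.exp (-(|(j : ℝ) - (i : ℝ)|) / 2))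
    (m N : ℕ) (hm : 1 ≤ m) (s η : ℝ) (hη : 0 < η) :
    P.real {ω | ∀ j ≤ N * m, Y j ω < s - η} ≤
      Real.exp (-(N * (gaussianReal 0 1).real (Set.Ici s)))
        + N * (2 * Real.exp (-m) / η ^ 2) := by
  have gp := aux_gp P Y hmeas hGauss
  have mean := aux_mean P Y hmeas hGauss
  obtain ⟨a, ha⟩ : ∃ a, a = Real.exp (-(m:ℝ)/2) := ⟨_, rfl⟩
  have ha0 : 0 < a := ha ▸ Real.exp_pos _
  have ha2 : a ^ 2 = Real.exp (-m) := by rw [ha, ← Real.exp_nat_mul]; congr 1; push_cast; ring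
  have hm' : (1:ℝ) ≤ m := by exact_mod_cast hm
  have ha1 : a ^ 2 < 1 := by rw [ha2, Real.exp_lt_one_iff]; linarith
  obtain ⟨σ, hσ⟩ : ∃ σ, σ = √(1 - a^2) := ⟨_, rfl⟩
  have hσ0 : 0 < σ := by rw [hσ]; apply Real.sqrt_pos.2; linarith
  have hσ2 : σ ^ 2 = 1 - a ^ 2 := by rw [hσ, Real.sq_sqrt]; linarith
  have hσ1 : 1 - a ^ 2 ≤ σ := by nlinarith [sq_nonneg a]
  have memY : ∀ j, MemLp (Y j) 2 P := fun j => (gp.hasGaussianLaw_eval j).memLp_two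
  have intY : ∀ j, Integrable (Y j) P := fun j => (memY j).integrable (by norm_num)
  have intYY : ∀ i j, Integrable (fun ω => Y i ω * Y j ω) P :=
    fun i j => (memY i).integrable_mul (memY j)
  have cov1 : ∀ i d : ℕ, ∫ ω, Y (i * m) ω * Y ((i + d) * m) ω ∂P = a ^ d := by
    intro i d
    rw [hcov, ha, ← Real.exp_nat_mul]
    congr 1
    push_cast
    have : ((i:ℝ) + d) * m - i * m = d * m := by ring
    rw [this, abs_of_nonneg (by positivity)]
    ring
  obtain ⟨Z, hZ⟩ : ∃ Z : ℕ → Ω → ℝ, ∀ i ω, Z i ω = σ⁻¹ * (Y ((i+1) * m) ω - a * Y (i * m) ω) :=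
    ⟨_, fun _ _ => rfl⟩
  have hZ' : ∀ i, Z i = fun ω => σ⁻¹ * (Y ((i+1) * m) ω - a * Y (i * m) ω) := fun i => funext (hZ i)
  have gpZ : IsGaussianProcess Z P := by
    classical
    refine gp.of_isGaussianProcess fun i => ⟨{(i+1)*m, i*m},
      σ⁻¹ • (ContinuousLinearMap.proj ⟨(i+1)*m, by simp⟩ - a • ContinuousLinearMap.proj ⟨i*m, by simp⟩), ?_⟩
    intro ω
    simp [hZ]
  have mZ : ∀ i, Measurable (Z i) := by
    intro i; rw [hZ']; fun_prop
  have memZ : ∀ j, MemLp (Z j) 2 P := fun j => (gpZ.hasGaussianLaw_eval j).memLp_two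
  have meanZ : ∀ i, ∫ ω, Z i ω ∂P = 0 := by
    intro i
    simp only [hZ]
    rw [integral_const_mul, integral_sub (intY _) ((intY _).const_mul _), integral_const_mul, mean, mean]
    simp
  have lin4 : ∀ i j k l : ℕ, ∀ b c d e : ℝ,
      ∫ ω, (b * Y i ω + c * Y j ω) * (d * Y k ω + e * Y l ω) ∂P
      = b * d * ∫ ω, Y i ω * Y k ω ∂P + b * e * ∫ ω, Y i ω * Y l ω ∂P
        + c * d * ∫ ω, Y j ω * Y k ω ∂P + c * e * ∫ ω, Y j ω * Y l ω ∂P := by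
    intro i j k l b c d e
    have : ∀ ω, (b * Y i ω + c * Y j ω) * (d * Y k ω + e * Y l ω)
      = b * d * (Y i ω * Y k ω) + b * e * (Y i ω * Y l ω) + c * d * (Y j ω * Y k ω)
        + c * e * (Y j ω * Y l ω) := fun ω => by ring
    simp only [this]
    rw [integral_add, integral_add, integral_add]
    · simp only [integral_const_mul]
    all_goals
      repeat' apply Integrable.add
      all_goals exact (intYY _ _).const_mul _
  have covZ : ∀ i j, i < j → ∫ ω, Z i ω * Z j ω ∂P = 0 := by
    intro i j hij
    obtain ⟨d, rfl⟩ := Nat.exists_eq_add_of_lt hij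
    have h := lin4 ((i+1)*m) (i*m) ((i+d+1+1)*m) ((i+d+1)*m) σ⁻¹ (-σ⁻¹*a) σ⁻¹ (-σ⁻¹*a)
    have e1 : (i + d + 1 + 1) = (i+1) + (d+1) := by ring
    have e2 : (i + d + 1) = (i+1) + d := by ring
    have e3 : (i + d + 1 + 1) = i + (d+2) := by ring
    have e4 : (i + d + 1) = i + (d+1) := by ring
    have c1 := cov1 (i+1) (d+1)
    have c2 := cov1 (i+1) d
    have c3 := cov1 i (d+2)
    have c4 := cov1 i (d+1)
    rw [← e1] at c1
    rw [← e2] at c2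
    rw [← e3] at c3
    rw [← e4] at c4
    rw [c1, c2, c3, c4] at h
    have : ∀ ω, Z i ω * Z (i+d+1) ω = (σ⁻¹ * Y ((i+1)*m) ω + -σ⁻¹*a * Y (i*m) ω) *
      (σ⁻¹ * Y ((i+d+1+1)*m) ω + -σ⁻¹*a * Y ((i+d+1)*m) ω) := fun ω => by
      rw [hZ, hZ]; ring
    simp only [this, h]
    ring
  have c00 : ∀ i, ∫ ω, Y (i * m) ω * Y (i * m) ω ∂P = 1 := fun i => by simpa using cov1 i 0
  have c01 : ∀ i, ∫ ω, Y (i * m) ω * Y ((i+1) * m) ω ∂P = a := fun i => by simpa using cov1 i 1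
  have c10 : ∀ i, ∫ ω, Y ((i+1) * m) ω * Y (i * m) ω ∂P = a := fun i => by
    rw [← c01 i]; congr 1; ext ω; ring
  have varZ : ∀ i, ∫ ω, Z i ω ^ 2 ∂P = 1 := by
    intro i
    have h := lin4 ((i+1)*m) (i*m) ((i+1)*m) (i*m) σ⁻¹ (-σ⁻¹*a) σ⁻¹ (-σ⁻¹*a)
    rw [c00, c00, c01, c10] at h
    have : ∀ ω, Z i ω ^ 2 = (σ⁻¹ * Y ((i+1)*m) ω + -σ⁻¹*a * Y (i*m) ω) *
      (σ⁻¹ * Y ((i+1)*m) ω + -σ⁻¹*a * Y (i*m) ω) := fun ω => by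
      rw [hZ]; ring
    simp only [this, h]
    field_simp
    linarith
  have varD : ∀ i, ∫ ω, (Y ((i+1)*m) ω - Z i ω) ^ 2 ∂P ≤ 2 * Real.exp (-m) := by
    intro i
    have h := lin4 ((i+1)*m) (i*m) ((i+1)*m) (i*m) (1-σ⁻¹) (σ⁻¹*a) (1-σ⁻¹) (σ⁻¹*a)
    rw [c00, c00, c01, c10] at h
    have : ∀ ω, (Y ((i+1)*m) ω - Z i ω) ^ 2 = ((1-σ⁻¹) * Y ((i+1)*m) ω + σ⁻¹*a * Y (i*m) ω) *
      ((1-σ⁻¹) * Y ((i+1)*m) ω + σ⁻¹*a * Y (i*m) ω) := fun ω => by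
      rw [hZ]; ring
    simp only [this, h]
    rw [← ha2]
    have e : (1 - σ⁻¹) * (1 - σ⁻¹) * 1 + (1 - σ⁻¹) * (σ⁻¹ * a) * a + σ⁻¹ * a * (1 - σ⁻¹) * a +
      σ⁻¹ * a * (σ⁻¹ * a) * 1 = 2 - 2 * σ := by
      have ha2' : a ^ 2 = 1 - σ ^ 2 := by linarith
      field_simp
      ring_nf
      rw [ha2']
      ring
    rw [e]; linarith
  have lawZ : ∀ i, P.map (Z i) = gaussianReal 0 1 := by
    intro i
    rw [(gpZ.hasGaussianLaw_eval i).map_eq_gaussianReal, meanZ,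
      variance_of_integral_eq_zero (mZ i).aemeasurable (meanZ i), varZ]
    simp
  have ind : iIndepFun (fun i : Finset.range N => Z i) P := by
    apply HasGaussianLaw.iIndepFun_of_covariance_eq_zero (gpZ.hasGaussianLaw (Finset.range N))
    intro i j hij
    change cov[Z i, Z j; P] = 0
    rw [covariance_eq_sub (memZ _) (memZ _), meanZ, zero_mul, sub_zero]
    have hij' : (i:ℕ) ≠ j := fun h => hij (Subtype.ext h)
    rcases lt_or_gt_of_ne hij' with h | h
    · exact covZ _ _ h
    · rw [mul_comm]; exact covZ _ _ h
  set p := (gaussianReal 0 1).real (Set.Ici s) with hp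
  have hq : ∀ i, P.real (Z i ⁻¹' Set.Iio s) = 1 - p := by
    intro i
    rw [← map_measureReal_apply (mZ i) measurableSet_Iio, lawZ, hp, ← probReal_compl_eq_one_sub measurableSet_Ici]
    simp
  have hmain : P.real (⋂ i : Finset.range N, Z i ⁻¹' Set.Iio s) ≤ Real.exp (-(N * p)) := by
    have h := ind.measure_inter_preimage_eq_mul Finset.univ (sets := fun _ => Set.Iio s)
      (fun _ _ => measurableSet_Iio)
    have h' : P.real (⋂ i : Finset.range N, Z i ⁻¹' Set.Iio s) = (1 - p) ^ N := by
      rw [measureReal_def]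
      simp only [Finset.mem_univ, Set.iInter_true] at h
      rw [h, ENNReal.toReal_prod]
      simp only [← measureReal_def, hq]
      simp
    rw [h']
    have hp1 : 0 ≤ 1 - p := by rw [← hq 0]; exact measureReal_nonneg
    calc (1-p)^N ≤ (Real.exp (-p))^N := by
          gcongr; linarith [Real.add_one_le_exp (-p)]
      _ = _ := by rw [← Real.exp_nat_mul]; congr 1; ring
  have cheb : ∀ i, P.real {ω | η ^ 2 ≤ (Y ((i+1)*m) ω - Z i ω) ^ 2} ≤ 2 * Real.exp (-m) / η ^ 2 := by
    intro i
    have h := mul_meas_ge_le_integral_of_nonneg (μ := P) (f := fun ω => (Y ((i+1)*m) ω - Z i ω) ^ 2)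
      (ae_of_all _ fun ω => sq_nonneg _) ((memY _).sub (memZ _)).integrable_sq (η^2)
    rw [le_div_iff₀ (by positivity)]
    linarith [varD i]
  have hsub : {ω | ∀ j ≤ N * m, Y j ω < s - η} ⊆ (⋂ i : Finset.range N, Z i ⁻¹' Set.Iio s) ∪
      ⋃ i ∈ Finset.range N, {ω | η ^ 2 ≤ (Y ((i+1)*m) ω - Z i ω) ^ 2} := by
    intro ω hω
    by_contra hc
    simp only [Set.mem_union, Set.mem_iInter, Set.mem_iUnion, Set.mem_preimage, Set.mem_Iio,
      Set.mem_ofPred_eq, not_or, not_forall, not_exists, not_le, not_lt] at hc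
    obtain ⟨⟨⟨i, hi⟩, h1⟩, h2⟩ := hc
    have h3 := h2 i hi
    have h4 := hω ((i+1)*m) (by
      have := Finset.mem_range.1 hi
      gcongr; omega)
    have h5 := abs_lt_of_sq_lt_sq h3 hη.le
    simp only at h1
    linarith [(abs_lt.1 h5).1]
  calc _ ≤ _ := measureReal_mono hsub
    _ ≤ _ := measureReal_union_le _ _
    _ ≤ _ := by
      refine add_le_add hmain ((measureReal_biUnion_finset_le _ _).trans ?_)
      refine (Finset.sum_le_sum fun i _ => cheb i).trans ?_
      simp

theorem aux_num (ε : ℝ) (hε : 0 < ε) : ∀ᶠ k : ℕ in atTop,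
    1 ≤ ⌈4 * Real.log k⌉₊ ∧
    2 * Real.log k ≤ ((k / ⌈4 * Real.log k⌉₊ : ℕ) : ℝ) *
      (gaussianReal 0 1).real (Set.Ici (√(2 * Real.log k) - ε / 2)) := by
  have hlog : Tendsto (fun k : ℕ => Real.log k) atTop atTop :=
    Real.tendsto_log_atTop.comp tendsto_natCast_atTop_atTop
  have ht : Tendsto (fun k : ℕ => √(2 * Real.log k)) atTop atTop :=
    Real.tendsto_sqrt_atTop.comp (hlog.const_mul_atTop (by norm_num))
  obtain ⟨c, hc⟩ : ∃ c, c = (ε / 4) * (√(2 * Real.pi))⁻¹ * Real.exp (-(ε ^ 2 / 32)) := ⟨_, rfl⟩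
  have hc0 : 0 < c := by rw [hc]; positivity
  have h1 : ∀ᶠ t : ℝ in atTop, t ^ 4 ≤ (c / 6) * Real.exp (ε / 4 * t) := by
    have := (isLittleO_pow_exp_pos_mul_atTop 4 (b := ε / 4) (by positivity)).bound
      (c := c / 6) (by positivity)
    filter_upwards [this] with t h
    rw [Real.norm_of_nonneg (by positivity), Real.norm_of_nonneg (Real.exp_nonneg _)] at h
    exact h
  have h2 : ∀ᶠ k : ℕ in atTop, 12 * Real.log k ≤ k := by
    have := (Real.isLittleO_log_id_atTop.comp_tendsto tendsto_natCast_atTop_atTop).bound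
      (c := 1 / 12) (by norm_num)
    filter_upwards [this] with k h
    simp only [Function.comp_apply, id, Real.norm_natCast] at h
    have := Real.le_norm_self (Real.log k)
    linarith
  filter_upwards [ht.eventually h1, h2, ht.eventually (eventually_ge_atTop (max 1 (ε / 2))),
    hlog.eventually (eventually_ge_atTop 1), eventually_ge_atTop 1] with k h1 h2 h3 h4 h5
  have hk : (1:ℝ) ≤ k := by exact_mod_cast h5
  have hk0 : (0:ℝ) < k := by linarith
  obtain ⟨t, hteq⟩ : ∃ t, t = √(2 * Real.log k) := ⟨_, rfl⟩
  rw [← hteq] at h1 h3 ⊢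
  have ht2 : t ^ 2 = 2 * Real.log k := by rw [hteq, Real.sq_sqrt]; linarith
  have ht1 : 1 ≤ t := (le_max_left _ _).trans h3
  have htε : ε / 2 ≤ t := (le_max_right _ _).trans h3
  obtain ⟨m, hm⟩ : ∃ m, m = ⌈4 * Real.log k⌉₊ := ⟨_, rfl⟩
  rw [← hm]
  have hm1 : (m : ℝ) ≤ 3 * t ^ 2 := by
    have := Nat.ceil_lt_add_one (a := 4 * Real.log k) (by linarith)
    rw [← hm] at this
    nlinarith
  have hm0 : 1 ≤ m := by rw [hm]; apply Nat.one_le_ceil_iff.2; linarith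
  have hm0' : (1:ℝ) ≤ m := by exact_mod_cast hm0
  refine ⟨hm0, ?_⟩
  have hN : (k:ℝ) / (6 * t ^ 2) ≤ ((k / m : ℕ) : ℝ) := by
    have h6 : (k:ℝ) < m * ((k / m : ℕ) : ℝ) + m := by
      have := Nat.lt_mul_div_succ k (show 0 < m by omega)
      have h7 : (k:ℝ) < ((m * (k / m + 1) : ℕ) : ℝ) := by exact_mod_cast this
      push_cast at h7 ⊢
      linarith
    have h8 : 1 ≤ k / m := by
      rw [Nat.one_le_div_iff (by omega)]
      have : (m:ℝ) ≤ k := by linarith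
      exact_mod_cast this
    have h8' : (1:ℝ) ≤ ((k / m : ℕ) : ℝ) := by exact_mod_cast h8
    rw [div_le_iff₀ (by positivity)]
    nlinarith
  have hp := aux_tail (t - ε / 2) (ε / 4) (by linarith) (by positivity)
  have hexp : Real.exp (-(t - ε / 2 + ε / 4) ^ 2 / 2)
      = (k:ℝ)⁻¹ * Real.exp (ε / 4 * t) * Real.exp (-(ε ^ 2 / 32)) := by
    rw [← Real.exp_log (inv_pos.2 hk0), Real.log_inv, ← Real.exp_add, ← Real.exp_add]
    congr 1
    linarith
  rw [hexp] at hp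
  calc 2 * Real.log k = t ^ 2 := ht2.symm
    _ ≤ (k:ℝ) / (6 * t ^ 2) * (ε / 4 * ((√(2 * Real.pi))⁻¹ *
        ((k:ℝ)⁻¹ * Real.exp (ε / 4 * t) * Real.exp (-(ε ^ 2 / 32))))) := by
        have : (k:ℝ) / (6 * t ^ 2) * (ε / 4 * ((√(2 * Real.pi))⁻¹ *
          ((k:ℝ)⁻¹ * Real.exp (ε / 4 * t) * Real.exp (-(ε ^ 2 / 32)))))
          = (c / 6 * Real.exp (ε / 4 * t)) / t ^ 2 := by
          rw [hc]; field_simp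
        rw [this, le_div_iff₀ (by positivity)]
        calc t ^ 2 * t ^ 2 = t ^ 4 := by ring
          _ ≤ _ := h1
    _ ≤ _ := by gcongr

theorem aux_ae {Ω : Type*} [MeasurableSpace Ω] (P : Measure Ω) [IsProbabilityMeasure P]
    (Y : ℕ → Ω → ℝ)
    (hmeas : ∀ j, Measurable (Y j))
    (hGauss : ∀ (s : Finset ℕ) (c : ℕ → ℝ), ∃ v : NNReal,
      P.map (fun ω => ∑ j ∈ s, c j * Y j ω) = gaussianReal 0 v)
    (hvar : ∀ j, ∫ ω, (Y j ω) ^ 2 ∂P = 1)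
    (hcov : ∀ i j, ∫ ω, Y i ω * Y j ω ∂P = Real.exp (-(|(j : ℝ) - (i : ℝ)|) / 2))
    (ε : ℝ) (hε : 0 < ε) :
    ∀ᵐ ω ∂P, ∀ᶠ k : ℕ in atTop, ∃ j ≤ k, √(2 * Real.log k) - ε ≤ Y j ω := by
  have hbound : ∀ᶠ k : ℕ in atTop, P.real {ω | ∀ j ≤ k, Y j ω < √(2 * Real.log k) - ε}
      ≤ (1 + 8 / ε ^ 2) * (1 / (k:ℝ) ^ 2) := by
    filter_upwards [aux_num ε hε, eventually_ge_atTop 1] with k ⟨hm, hk⟩ hk1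
    have hk' : (1:ℝ) ≤ k := by exact_mod_cast hk1
    have hk0 : (0:ℝ) < k := by linarith
    obtain ⟨m, hmeq⟩ : ∃ m, m = ⌈4 * Real.log k⌉₊ := ⟨_, rfl⟩
    rw [← hmeq] at hm hk
    have hb := aux_block P Y hmeas hGauss hvar hcov m (k / m) hm (√(2 * Real.log k) - ε / 2)
      (ε / 2) (by positivity)
    have hsub : {ω | ∀ j ≤ k, Y j ω < √(2 * Real.log k) - ε} ⊆
        {ω | ∀ j ≤ k / m * m, Y j ω < √(2 * Real.log k) - ε / 2 - ε / 2} := by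
      intro ω hω j hj
      have := hω j (hj.trans (Nat.div_mul_le_self _ _))
      linarith
    refine (measureReal_mono hsub).trans (hb.trans ?_)
    have e1 : Real.exp (-(((k / m : ℕ) : ℝ) *
        (gaussianReal 0 1).real (Set.Ici (√(2 * Real.log k) - ε / 2)))) ≤ 1 / (k:ℝ) ^ 2 := by
      have : 1 / (k:ℝ) ^ 2 = Real.exp (-(2 * Real.log k)) := by
        rw [Real.exp_neg, one_div, mul_comm, Real.exp_mul, Real.exp_log hk0]; norm_num
      rw [this]
      gcongr
    have e2 : Real.exp (-m) ≤ 1 / (k:ℝ) ^ 4 := by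
      have : 1 / (k:ℝ) ^ 4 = Real.exp (-(4 * Real.log k)) := by
        rw [Real.exp_neg, one_div, mul_comm, Real.exp_mul, Real.exp_log hk0]; norm_num
      rw [this]
      gcongr
      rw [hmeq]; exact Nat.le_ceil _
    have e3 : ((k / m : ℕ) : ℝ) ≤ k := by exact_mod_cast Nat.div_le_self _ _
    have e4 : ((k / m : ℕ) : ℝ) * (2 * Real.exp (-m) / (ε / 2) ^ 2) ≤ 8 / ε ^ 2 * (1 / (k:ℝ) ^ 2) := by
      calc _ ≤ (k:ℝ) ^ 2 * (2 * (1 / (k:ℝ) ^ 4) / (ε / 2) ^ 2) := by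
            gcongr
            nlinarith
        _ = _ := by field_simp; norm_num
    linarith
  obtain ⟨K, hK⟩ := eventually_atTop.1 hbound
  have hsum : Summable (fun k : ℕ => (1 + 8 / ε ^ 2) * (1 / ((k + K : ℕ):ℝ) ^ 2)) :=
    ((summable_nat_add_iff K).2 (Real.summable_one_div_nat_pow.2 (by norm_num : 1 < 2))).mul_left _
  have hBC := ae_eventually_notMem (μ := P)
    (s := fun k : ℕ => {ω | ∀ j ≤ k + K, Y j ω < √(2 * Real.log (k + K : ℕ)) - ε}) (by
      refine ne_top_of_le_ne_top hsum.tsum_ofReal_ne_top (ENNReal.tsum_le_tsum fun k => ?_)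
      rw [← ofReal_measureReal]
      exact ENNReal.ofReal_le_ofReal (hK (k + K) (by omega)))
  filter_upwards [hBC] with ω hω
  rw [← map_add_atTop_eq_nat K, eventually_map]
  filter_upwards [hω] with k hk
  simpa using hk

/-- If `(Y_j)` is a centered stationary Gaussian sequence with unit variances
and covariances `E[Y_i Y_j] = e^{-|j-i|/2}`, then almost surely
`liminf_k [max_{0 ≤ j ≤ k} Y_j − √(2 log k)] ≥ 0`. -/
theorem liminf_max_stationary_gaussian
    {Ω : Type*} [MeasurableSpace Ω] (P : Measure Ω) [IsProbabilityMeasure P]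
    (Y : ℕ → Ω → ℝ)
    (hmeas : ∀ j, Measurable (Y j))
    (hGauss : ∀ (s : Finset ℕ) (c : ℕ → ℝ), ∃ v : NNReal,
      P.map (fun ω => ∑ j ∈ s, c j * Y j ω) = gaussianReal 0 v)
    (hvar : ∀ j, ∫ ω, (Y j ω) ^ 2 ∂P = 1)
    (hcov : ∀ i j, ∫ ω, Y i ω * Y j ω ∂P = Real.exp (-(|(j : ℝ) - (i : ℝ)|) / 2)) :
    ∀ᵐ ω ∂P, 0 ≤
      liminf (fun k : ℕ =>
        sSup ((fun j => Y j ω) '' Set.Iic k) - Real.sqrt (2 * Real.log k)) atTop := by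
  have h : ∀ᵐ ω ∂P, ∀ n : ℕ, ∀ᶠ k : ℕ in atTop,
      ∃ j ≤ k, √(2 * Real.log k) - 1 / ((n:ℝ) + 1) ≤ Y j ω :=
    ae_all_iff.2 fun n => aux_ae P Y hmeas hGauss hvar hcov _ (by positivity)
  filter_upwards [h] with ω hω
  rw [liminf_eq]
  by_cases hbd : BddAbove {a : ℝ | ∀ᶠ k : ℕ in atTop,
      a ≤ sSup ((fun j => Y j ω) '' Set.Iic k) - Real.sqrt (2 * Real.log k)}
  · refine le_of_forall_pos_le_add fun δ hδ => ?_
    obtain ⟨n, hn⟩ := exists_nat_one_div_lt hδ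
    have : -(1 / ((n:ℝ) + 1)) ≤ sSup {a : ℝ | ∀ᶠ k : ℕ in atTop,
        a ≤ sSup ((fun j => Y j ω) '' Set.Iic k) - Real.sqrt (2 * Real.log k)} := by
      apply le_csSup hbd
      filter_upwards [hω n] with k ⟨j, hj, hk⟩
      have := le_csSup (((Set.finite_Iic k).image (fun j => Y j ω)).bddAbove)
        (Set.mem_image_of_mem (fun j => Y j ω) (Set.mem_Iic.2 hj))
      linarith
    linarith
  · rw [Real.sSup_of_not_bddAbove hbd]
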